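/- (Kahn–Kalai–Linial) There is an absolute constant C > 0 such that for every n ≥ 1 and every Boolean function f : C_n → {0,1} there exists a coordinate i ∈ {1,…,n} with I_i(f) ≥ C · Var_{μⁿ}(f) · (log n)/n. -/

import Mathlib

open scoped Classical

/-- Expectation on the discrete cube `{-1,1}ⁿ ≃ (Fin n → Bool)` under the uniform measure. -/
noncomputable def EC {n : ℕ} (g : (Fin n → Bool) → ℝ) : ℝ :=
  (∑ x : Fin n → Bool, g x) / 2 ^ n

/-- Variance on the discrete cube under the uniform measure. -/
noncomputable def varC {n : ℕ} (g : (Fin n → Bool) → ℝ) : ℝ :=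
  EC (fun x => g x ^ 2) - (EC g) ^ 2

/-- `cubeFlip i x` is `x` with its `i`-th coordinate flipped. -/
def cubeFlip {n : ℕ} (i : Fin n) (x : Fin n → Bool) : Fin n → Bool :=
  Function.update x i (!x i)

/-- The influence of the `i`-th coordinate of `f` : the probability (under the uniform
measure) that `f(X) ≠ f(τᵢ X)`. -/
noncomputable def influence {n : ℕ} (i : Fin n) (f : (Fin n → Bool) → ℝ) : ℝ :=
  EC (fun x => if f x ≠ f (cubeFlip i x) then (1 : ℝ) else 0)

section Expectation

variable {n : ℕ}

lemma EC_add (f g : (Fin n → Bool) → ℝ) : EC (fun x => f x + g x) = EC f + EC g := by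
  simp only [EC, Finset.sum_add_distrib, add_div]

lemma EC_const_mul (c : ℝ) (f : (Fin n → Bool) → ℝ) : EC (fun x => c * f x) = c * EC f := by
  simp only [EC, ← Finset.mul_sum, mul_div_assoc]

lemma EC_sum {α : Type*} (s : Finset α) (f : α → (Fin n → Bool) → ℝ) :
    EC (fun x => ∑ a ∈ s, f a x) = ∑ a ∈ s, EC (f a) := by
  simp only [EC, Finset.sum_div]
  exact Finset.sum_comm

lemma EC_mono {f g : (Fin n → Bool) → ℝ} (h : ∀ x, f x ≤ g x) : EC f ≤ EC g := by
  unfold EC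
  gcongr with x
  exact h x

lemma EC_const (c : ℝ) : EC (fun _ : Fin n → Bool => c) = c := by
  simp [EC]

lemma EC_nonneg {f : (Fin n → Bool) → ℝ} (h : ∀ x, 0 ≤ f x) : 0 ≤ EC f := by
  simpa only [EC_const] using EC_mono h

/-- Cauchy–Schwarz on the discrete cube. -/
lemma EC_mul_sq_le (f g : (Fin n → Bool) → ℝ) :
    EC (fun x => f x * g x) ^ 2 ≤ EC (fun x => f x ^ 2) * EC (fun x => g x ^ 2) := by
  have h := Finset.sum_mul_sq_le_sq_mul_sq Finset.univ f g
  simp only [EC]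
  rw [div_pow, div_mul_div_comm, ← sq]
  gcongr

lemma cubeFlip_involutive (i : Fin n) : Function.Involutive (cubeFlip i) := by
  intro x
  simp [cubeFlip]

lemma EC_cubeFlip (i : Fin n) (f : (Fin n → Bool) → ℝ) :
    EC (fun x => f (cubeFlip i x)) = EC f := by
  unfold EC
  congr 1
  exact Equiv.sum_comp (cubeFlip_involutive i).toPerm f

end Expectation

section Walsh

variable {n : ℕ}

/-- The Walsh character `x ↦ ∏_{i ∈ S} x_i`. -/
def walsh (S : Finset (Fin n)) (x : Fin n → Bool) : ℝ :=
  ∏ i ∈ S, if x i then (1 : ℝ) else -1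

/-- The Walsh–Fourier coefficient of `f` at `S`. -/
noncomputable def walshCoeff (f : (Fin n → Bool) → ℝ) (S : Finset (Fin n)) : ℝ :=
  EC (fun x => f x * walsh S x)

lemma walsh_cubeFlip_of_notMem {i : Fin n} {S : Finset (Fin n)} (h : i ∉ S)
    (x : Fin n → Bool) : walsh S (cubeFlip i x) = walsh S x := by
  refine Finset.prod_congr rfl fun j hj => ?_
  rw [cubeFlip, Function.update_of_ne (ne_of_mem_of_not_mem hj h)]

lemma walsh_insert {i : Fin n} {S : Finset (Fin n)} (h : i ∉ S) (x : Fin n → Bool) :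
    walsh (insert i S) x = (if x i then (1 : ℝ) else -1) * walsh S x :=
  Finset.prod_insert h

lemma walsh_cubeFlip_of_mem {i : Fin n} {S : Finset (Fin n)} (h : i ∈ S)
    (x : Fin n → Bool) : walsh S (cubeFlip i x) = -walsh S x := by
  rw [← Finset.insert_erase h, walsh_insert (Finset.notMem_erase i S),
    walsh_insert (Finset.notMem_erase i S), walsh_cubeFlip_of_notMem (Finset.notMem_erase i S)]
  cases hx : x i <;> simp [cubeFlip, hx]

lemma sum_walsh_mul_walsh (x y : Fin n → Bool) :
    ∑ S : Finset (Fin n), walsh S x * walsh S y = if x = y then (2 : ℝ) ^ n else 0 := by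
  have h : ∑ S : Finset (Fin n), walsh S x * walsh S y =
      ∏ i : Fin n, (1 + (if x i then (1 : ℝ) else -1) * (if y i then (1 : ℝ) else -1)) := by
    rw [Finset.prod_one_add, Finset.powerset_univ]
    exact Finset.sum_congr rfl fun S _ => Finset.prod_mul_distrib.symm
  rw [h]
  split_ifs with hxy
  · subst hxy
    rw [Finset.prod_congr rfl (g := fun _ => (2 : ℝ))]
    · simp
    · intro i _
      cases x i <;> norm_num
  · obtain ⟨i, hi⟩ := Function.ne_iff.mp hxy
    refine Finset.prod_eq_zero (Finset.mem_univ i) ?_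
    cases hx : x i <;> cases hy : y i <;> simp_all

/-- The Parseval identity on the discrete cube. -/
lemma sum_walshCoeff_sq (f : (Fin n → Bool) → ℝ) :
    ∑ S : Finset (Fin n), walshCoeff f S ^ 2 = EC (fun x => f x ^ 2) := by
  have h : ∑ S : Finset (Fin n), (∑ x, f x * walsh S x) ^ 2 = 2 ^ n * ∑ x, f x ^ 2 := by
    calc ∑ S : Finset (Fin n), (∑ x, f x * walsh S x) ^ 2
        = ∑ S : Finset (Fin n), ∑ x, ∑ y, f x * f y * (walsh S x * walsh S y) := by
          refine Finset.sum_congr rfl fun S _ => ?_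
          rw [sq, Finset.sum_mul_sum]
          refine Finset.sum_congr rfl fun x _ => Finset.sum_congr rfl fun y _ => ?_
          ring
      _ = ∑ x, ∑ y, f x * f y * ∑ S : Finset (Fin n), walsh S x * walsh S y := by
          rw [Finset.sum_comm]
          refine Finset.sum_congr rfl fun x _ => ?_
          rw [Finset.sum_comm]
          refine Finset.sum_congr rfl fun y _ => ?_
          rw [Finset.mul_sum]
      _ = 2 ^ n * ∑ x, f x ^ 2 := by
          simp only [sum_walsh_mul_walsh, mul_ite, mul_zero, Finset.sum_ite_eq,
            Finset.mem_univ, if_true, Finset.mul_sum]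
          refine Finset.sum_congr rfl fun x _ => ?_
          ring
  simp only [walshCoeff, EC, div_pow]
  rw [← Finset.sum_div, h]
  field_simp

lemma varC_eq_sum_walshCoeff_sq (f : (Fin n → Bool) → ℝ) :
    varC f = ∑ S ∈ Finset.univ.erase ∅, walshCoeff f S ^ 2 := by
  rw [varC, ← sum_walshCoeff_sq, ← Finset.add_sum_erase _ _ (Finset.mem_univ ∅)]
  simp [walshCoeff, walsh]

/-- The difference of `f` along the `i`-th coordinate. -/
def flipDiff (i : Fin n) (f : (Fin n → Bool) → ℝ) (x : Fin n → Bool) : ℝ :=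
  f x - f (cubeFlip i x)

lemma walshCoeff_flipDiff (i : Fin n) (f : (Fin n → Bool) → ℝ) (S : Finset (Fin n)) :
    walshCoeff (flipDiff i f) S = if i ∈ S then 2 * walshCoeff f S else 0 := by
  have h : walshCoeff (flipDiff i f) S =
      EC (fun x => f x * walsh S x) + (-1) * EC (fun x => f x * walsh S (cubeFlip i x)) := by
    rw [← EC_cubeFlip i (fun x => f x * walsh S (cubeFlip i x)), ← EC_const_mul, ← EC_add]
    simp only [walshCoeff, flipDiff, cubeFlip_involutive i _]
    congr 1
    ext x
    ring
  rw [h]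
  split_ifs with hi
  · simp only [walsh_cubeFlip_of_mem hi]
    rw [← EC_const_mul, ← EC_add, walshCoeff, ← EC_const_mul]
    congr 1
    ext x
    ring
  · simp only [walsh_cubeFlip_of_notMem hi]
    ring

/-- The `(2, 4)` hypercontractive inequality of Bonami. -/
lemma EC_walsh_sum_pow_four_le (U : Finset (Fin n)) (b : Finset (Fin n) → ℝ) :
    EC (fun x => (∑ S ∈ U.powerset, b S * walsh S x) ^ 4) ≤
      (∑ S ∈ U.powerset, 3 ^ S.card * b S ^ 2) ^ 2 := by
  induction U using Finset.induction_on generalizing b with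
  | empty =>
    simp only [Finset.powerset_empty, Finset.sum_singleton, walsh, Finset.prod_empty, mul_one,
      Finset.card_empty, pow_zero, one_mul, EC_const]
    exact le_of_eq (by ring)
  | insert i U hi ih =>
    set P : (Fin n → Bool) → ℝ := fun x => ∑ S ∈ U.powerset, b S * walsh S x
    set Q : (Fin n → Bool) → ℝ := fun x => ∑ S ∈ U.powerset, b (insert i S) * walsh S x
    set p : ℝ := ∑ S ∈ U.powerset, 3 ^ S.card * b S ^ 2 with hp
    set q : ℝ := ∑ S ∈ U.powerset, 3 ^ S.card * b (insert i S) ^ 2 with hq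
    have notMem {S : Finset (Fin n)} (hS : S ∈ U.powerset) : i ∉ S := fun h =>
      hi (Finset.mem_powerset.mp hS h)
    have hp0 : 0 ≤ p := Finset.sum_nonneg fun S _ => by positivity
    have hq0 : 0 ≤ q := Finset.sum_nonneg fun S _ => by positivity
    have hP : EC (fun x => P x ^ 4) ≤ p ^ 2 := ih b
    have hQ : EC (fun x => Q x ^ 4) ≤ q ^ 2 := ih fun S => b (insert i S)
    have hPQ : EC (fun x => P x ^ 2 * Q x ^ 2) ≤ p * q := by
      refine abs_le_of_sq_le_sq' ?_ (by positivity) |>.2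
      refine (EC_mul_sq_le _ _).trans ?_
      simp only [← pow_mul, Nat.reduceMul]
      rw [mul_pow]
      exact mul_le_mul hP hQ (EC_nonneg fun x => by positivity) (by positivity)
    have hPflip (x) : P (cubeFlip i x) = P x := Finset.sum_congr rfl fun S hS => by
      rw [walsh_cubeFlip_of_notMem (notMem hS)]
    have hQflip (x) : Q (cubeFlip i x) = Q x := Finset.sum_congr rfl fun S hS => by
      rw [walsh_cubeFlip_of_notMem (notMem hS)]
    have hsum (x : Fin n → Bool) : ∑ S ∈ (insert i U).powerset, b S * walsh S x =
        P x + (if x i then (1 : ℝ) else -1) * Q x := by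
      rw [Finset.sum_powerset_insert hi]
      congr 1
      rw [Finset.mul_sum]
      refine Finset.sum_congr rfl fun S hS => ?_
      rw [walsh_insert (notMem hS)]
      ring
    have hweight : ∑ S ∈ (insert i U).powerset, 3 ^ S.card * b S ^ 2 = p + 3 * q := by
      rw [Finset.sum_powerset_insert hi, hp, hq, Finset.mul_sum]
      congr 1
      refine Finset.sum_congr rfl fun S hS => ?_
      rw [Finset.card_insert_of_notMem (notMem hS)]
      ring
    have hexp : 2 * EC (fun x => (P x + (if x i then (1 : ℝ) else -1) * Q x) ^ 4) =
        2 * (EC (fun x => P x ^ 4) + 6 * EC (fun x => P x ^ 2 * Q x ^ 2) +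
          EC (fun x => Q x ^ 4)) := by
      rw [two_mul]
      nth_rw 2 [← EC_cubeFlip i]
      rw [← EC_const_mul 6, ← EC_add, ← EC_add, ← EC_add, ← EC_const_mul]
      congr 1
      ext x
      rw [hPflip, hQflip]
      cases hx : x i <;> simp only [cubeFlip, Function.update_self, hx, Bool.not_true,
        Bool.not_false, Bool.false_eq_true, if_true, if_false] <;> ring
    simp only [hsum]
    rw [hweight]
    nlinarith [mul_nonneg hp0 hq0, sq_nonneg q]

/-- The `(4/3, 2)` hypercontractive inequality for functions with values in `{-1, 0, 1}`. -/
lemma sum_walshCoeff_sq_div_three_pow_sq_le (g : (Fin n → Bool) → ℝ)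
    (hg : ∀ x, g x ^ 3 = g x) :
    (∑ S : Finset (Fin n), walshCoeff g S ^ 2 / 3 ^ S.card) ^ 2 ≤
      EC (fun x => g x ^ 2) ^ 3 := by
  set A : ℝ := ∑ S : Finset (Fin n), walshCoeff g S ^ 2 / 3 ^ S.card
  set I : ℝ := EC (fun x => g x ^ 2)
  set h : (Fin n → Bool) → ℝ := fun x =>
    ∑ S : Finset (Fin n), walshCoeff g S / 3 ^ S.card * walsh S x
  have hI : 0 ≤ I := EC_nonneg fun x => sq_nonneg _
  have hA : 0 ≤ A := Finset.sum_nonneg fun S _ => by positivity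
  have hgh : EC (fun x => g x * (g x ^ 2 * h x)) = A := by
    calc EC (fun x => g x * (g x ^ 2 * h x))
        = EC (fun x => ∑ S : Finset (Fin n), walshCoeff g S / 3 ^ S.card * (g x * walsh S x)) := by
          congr 1
          ext x
          rw [← mul_assoc, ← pow_succ', hg, Finset.mul_sum]
          refine Finset.sum_congr rfl fun S _ => ?_
          ring
      _ = A := by
          rw [EC_sum]
          refine Finset.sum_congr rfl fun S _ => ?_
          rw [EC_const_mul]
          change _ * walshCoeff g S = _
          ring
  have hh : EC (fun x => h x ^ 4) ≤ A ^ 2 := by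
    have := EC_walsh_sum_pow_four_le Finset.univ fun S : Finset (Fin n) =>
      walshCoeff g S / 3 ^ S.card
    rw [Finset.powerset_univ] at this
    refine this.trans_eq ?_
    congr 1
    refine Finset.sum_congr rfl fun S _ => ?_
    field_simp
  have hsq (x) : (g x ^ 2) ^ 2 = g x ^ 2 := by
    linear_combination g x * hg x
  have h₁ : A ^ 2 ≤ I * EC (fun x => g x ^ 2 * h x ^ 2) := by
    have := EC_mul_sq_le g fun x => g x ^ 2 * h x
    simpa only [hgh, mul_pow, hsq] using this
  have h₂ : EC (fun x => g x ^ 2 * h x ^ 2) ^ 2 ≤ I * A ^ 2 := by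
    refine (EC_mul_sq_le (fun x => g x ^ 2) fun x => h x ^ 2).trans ?_
    simp only [hsq, ← pow_mul, Nat.reduceMul]
    exact mul_le_mul_of_nonneg_left hh hI
  have h₃ : A ^ 2 * A ^ 2 ≤ I ^ 3 * A ^ 2 := by
    calc A ^ 2 * A ^ 2
        ≤ (I * EC (fun x => g x ^ 2 * h x ^ 2)) * (I * EC (fun x => g x ^ 2 * h x ^ 2)) :=
          mul_le_mul h₁ h₁ (sq_nonneg A) ((sq_nonneg A).trans h₁)
      _ = I ^ 2 * EC (fun x => g x ^ 2 * h x ^ 2) ^ 2 := by ring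
      _ ≤ I ^ 2 * (I * A ^ 2) := mul_le_mul_of_nonneg_left h₂ (sq_nonneg I)
      _ = I ^ 3 * A ^ 2 := by ring
  rcases hA.eq_or_lt with h0 | h0
  · rw [← h0, zero_pow two_ne_zero]
    positivity
  · exact le_of_mul_le_mul_right h₃ (by positivity)

lemma sum_sum_ite_mem (w : Finset (Fin n) → ℝ) :
    ∑ i : Fin n, ∑ S : Finset (Fin n), (if i ∈ S then w S else 0) =
      ∑ S : Finset (Fin n), S.card * w S := by
  rw [Finset.sum_comm]
  refine Finset.sum_congr rfl fun S _ => ?_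
  simp

end Walsh

section Boolean

variable {n : ℕ} {f : (Fin n → Bool) → ℝ}

lemma flipDiff_pow_three (hf : ∀ x, f x = 0 ∨ f x = 1) (i : Fin n) (x : Fin n → Bool) :
    flipDiff i f x ^ 3 = flipDiff i f x := by
  rcases hf x with h | h <;> rcases hf (cubeFlip i x) with h' | h' <;>
    norm_num [flipDiff, h, h']

lemma EC_flipDiff_sq (hf : ∀ x, f x = 0 ∨ f x = 1) (i : Fin n) :
    EC (fun x => flipDiff i f x ^ 2) = influence i f := by
  unfold influence
  congr 1
  ext x
  rcases hf x with h | h <;> rcases hf (cubeFlip i x) with h' | h' <;> simp [flipDiff, h, h']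

lemma influence_nonneg (i : Fin n) (f : (Fin n → Bool) → ℝ) : 0 ≤ influence i f :=
  EC_nonneg fun x => by positivity

lemma varC_le_one (hf : ∀ x, f x = 0 ∨ f x = 1) : varC f ≤ 1 := by
  have h : EC (fun x => f x ^ 2) ≤ EC (fun _ : Fin n → Bool => (1 : ℝ)) :=
    EC_mono fun x => by rcases hf x with h | h <;> simp [h]
  rw [EC_const] at h
  rw [varC]
  nlinarith [sq_nonneg (EC f)]

/-- The total influence is four times the spectral first moment. -/
lemma four_mul_sum_card_mul_walshCoeff_sq (hf : ∀ x, f x = 0 ∨ f x = 1) :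
    4 * ∑ S : Finset (Fin n), S.card * walshCoeff f S ^ 2 = ∑ i, influence i f := by
  rw [← sum_sum_ite_mem, Finset.mul_sum]
  refine Finset.sum_congr rfl fun i _ => ?_
  rw [← EC_flipDiff_sq hf, ← sum_walshCoeff_sq, Finset.mul_sum]
  refine Finset.sum_congr rfl fun S _ => ?_
  rw [walshCoeff_flipDiff]
  split_ifs <;> ring

lemma four_mul_sum_walshCoeff_sq_div_three_pow_le (hf : ∀ x, f x = 0 ∨ f x = 1) {B : ℝ}
    (hB : ∀ i, influence i f ≤ B) :
    4 * ∑ S ∈ Finset.univ.erase (∅ : Finset (Fin n)), walshCoeff f S ^ 2 / 3 ^ S.card ≤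
      n * √(B ^ 3) := by
  calc 4 * ∑ S ∈ Finset.univ.erase (∅ : Finset (Fin n)), walshCoeff f S ^ 2 / 3 ^ S.card
      ≤ 4 * ∑ S ∈ Finset.univ.erase (∅ : Finset (Fin n)),
          S.card * (walshCoeff f S ^ 2 / 3 ^ S.card) := by
        gcongr with S hS
        refine le_mul_of_one_le_left (by positivity) ?_
        exact_mod_cast Finset.card_pos.mpr
          (Finset.nonempty_iff_ne_empty.mpr (Finset.ne_of_mem_erase hS))
    _ = 4 * ∑ S : Finset (Fin n), S.card * (walshCoeff f S ^ 2 / 3 ^ S.card) := by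
        rw [Finset.sum_erase]
        simp
    _ = ∑ i : Fin n, ∑ S : Finset (Fin n), walshCoeff (flipDiff i f) S ^ 2 / 3 ^ S.card := by
        rw [← sum_sum_ite_mem, Finset.mul_sum]
        refine Finset.sum_congr rfl fun i _ => ?_
        rw [Finset.mul_sum]
        refine Finset.sum_congr rfl fun S _ => ?_
        rw [walshCoeff_flipDiff]
        split_ifs <;> ring
    _ ≤ ∑ _i : Fin n, √(B ^ 3) := by
        gcongr with i
        refine Real.le_sqrt_of_sq_le ?_
        refine (sum_walshCoeff_sq_div_three_pow_sq_le _ (flipDiff_pow_three hf i)).trans ?_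
        rw [EC_flipDiff_sq hf]
        exact pow_le_pow_left₀ (influence_nonneg i f) (hB i) 3
    _ = n * √(B ^ 3) := by simp

/-- A tangent-line form of the Jensen inequality for the spectral distribution. -/
lemma varC_mul_exp_le (f : (Fin n → Bool) → ℝ) {d : ℝ}
    (hd : ∑ S : Finset (Fin n), S.card * walshCoeff f S ^ 2 ≤ d * varC f) :
    varC f * Real.exp (-(d * Real.log 3)) ≤
      ∑ S ∈ Finset.univ.erase (∅ : Finset (Fin n)), walshCoeff f S ^ 2 / 3 ^ S.card := by
  have hlog : 0 ≤ Real.log 3 := Real.log_nonneg (by norm_num)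
  have hpoint (S : Finset (Fin n)) : Real.exp (-(d * Real.log 3)) *
      ((1 + d * Real.log 3) * walshCoeff f S ^ 2 - Real.log 3 * (S.card * walshCoeff f S ^ 2)) ≤
      walshCoeff f S ^ 2 / 3 ^ S.card := by
    have h3 : ((3 : ℝ) ^ S.card)⁻¹ =
        Real.exp (-(d * Real.log 3)) * Real.exp ((d - S.card) * Real.log 3) := by
      rw [← Real.exp_add, ← Real.exp_log (show (0 : ℝ) < 3 by norm_num), ← Real.exp_nat_mul,
        ← Real.exp_neg, Real.log_exp]
      congr 1
      ring
    have htan := Real.add_one_le_exp ((d - S.card) * Real.log 3)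
    rw [div_eq_mul_inv, h3]
    calc _ = walshCoeff f S ^ 2 * (Real.exp (-(d * Real.log 3)) *
            ((d - S.card) * Real.log 3 + 1)) := by ring
      _ ≤ _ := by gcongr
  refine le_trans ?_ (Finset.sum_le_sum fun S _ => hpoint S)
  rw [← Finset.mul_sum, Finset.sum_sub_distrib, ← Finset.mul_sum, ← Finset.mul_sum,
    ← varC_eq_sum_walshCoeff_sq, Finset.sum_erase Finset.univ
      (f := fun S : Finset (Fin n) => (S.card : ℝ) * walshCoeff f S ^ 2) (by simp), mul_comm]
  gcongr
  nlinarith [mul_le_mul_of_nonneg_left hd hlog]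

end Boolean

/-- Kahn–Kalai–Linial: there is an absolute constant `C > 0` such that every Boolean
function on the discrete cube has a coordinate with influence at least
`C · Var(f) · log n / n`. -/
theorem kahn_kalai_linial :
    ∃ C : ℝ, 0 < C ∧ ∀ n : ℕ, 1 ≤ n → ∀ f : (Fin n → Bool) → ℝ,
      (∀ x, f x = 0 ∨ f x = 1) →
      ∃ i : Fin n, C * varC f * (Real.log n / n) ≤ influence i f := by
  refine ⟨1 / 4, by norm_num, fun n hn f hf => ?_⟩
  by_contra! hlt
  set V := varC f
  set L := Real.log n with hL
  have hn0 : (0 : ℝ) < n := by exact_mod_cast hn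
  have hB := (influence_nonneg ⟨0, hn⟩ f).trans_lt (hlt ⟨0, hn⟩)
  have hL0 : 0 ≤ L := Real.log_nonneg (by exact_mod_cast hn)
  have hV0 : 0 < V := by
    by_contra! h
    exact hB.not_ge (mul_nonpos_of_nonpos_of_nonneg (by linarith) (by positivity))
  set B := 1 / 4 * V * (L / n) with hBdef
  have hspec : ∑ S : Finset (Fin n), S.card * walshCoeff f S ^ 2 ≤ L / 16 * V := by
    have h₁ : ∑ i, influence i f ≤ ∑ _i : Fin n, B := Finset.sum_le_sum fun i _ => (hlt i).le
    rw [← four_mul_sum_card_mul_walshCoeff_sq hf, Finset.sum_const, Finset.card_univ,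
      Fintype.card_fin, nsmul_eq_mul] at h₁
    have h₂ : n * B = 1 / 4 * V * L := by
      rw [hBdef]
      field_simp
    linarith
  have hlog3 : Real.log 3 ≤ 2 :=
    (Real.log_le_sub_one_of_pos (by norm_num)).trans (by norm_num)
  have hmain : 4 * (V * Real.exp (-(L / 8))) ≤ n * √(B ^ 3) := by
    refine le_trans ?_ (four_mul_sum_walshCoeff_sq_div_three_pow_le hf fun i => (hlt i).le)
    refine le_trans ?_ (mul_le_mul_of_nonneg_left (varC_mul_exp_le f hspec) (by norm_num))
    gcongr
    nlinarith
  have hsq : (4 * (V * Real.exp (-(L / 8)))) ^ 2 ≤ (n * √(B ^ 3)) ^ 2 := by gcongr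
  have hleft : (4 * (V * Real.exp (-(L / 8)))) ^ 2 * n =
      V ^ 2 * (16 * Real.exp (L / 4) ^ 3) := by
    have hexp : Real.exp (-(L / 8)) ^ 2 * n = Real.exp (L / 4) ^ 3 := by
      nth_rw 1 [← Real.exp_log hn0]
      rw [← Real.exp_nat_mul, ← Real.exp_nat_mul, ← Real.exp_add, ← hL]
      congr 1
      push_cast
      ring
    rw [← hexp]
    ring
  have hright : (n * √(B ^ 3)) ^ 2 * n = V ^ 2 * (V * (L / 4) ^ 3) := by
    rw [mul_pow, Real.sq_sqrt (by positivity), hBdef]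
    field_simp
  have hcmp : 16 * Real.exp (L / 4) ^ 3 ≤ V * (L / 4) ^ 3 := by
    refine le_of_mul_le_mul_left ?_ (pow_pos hV0 2)
    rw [← hleft, ← hright]
    gcongr
  have hLexp : (L / 4) ^ 3 ≤ Real.exp (L / 4) ^ 3 := by
    gcongr
    linarith [Real.add_one_le_exp (L / 4)]
  have hVL : V * (L / 4) ^ 3 ≤ 1 * (L / 4) ^ 3 := by
    gcongr
    exact varC_le_one hf
  have hpos : 0 < Real.exp (L / 4) ^ 3 := by positivity
  linarith
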